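/- arXiv:2501.18381 — 5 statements merged into one kernel-verified Lean document; each statement's English description precedes it below -/
import Mathlib

section
/- Let E be a finite-dimensional real inner product space, X ⊆ E compact convex, L > 0 and μ > 0. Let f : E → ℝ be differentiable, convex on X, with gradient L-Lipschitz on X; let g : E → ℝ be convex on X and lower semicontinuous; assume F := f + g is μ-strongly convex on X, and let x* be the minimizer of F on X. Suppose x_0 ∈ X and for each t the iterate x_{t+1} is a minimizer over X of y ↦ ⟨∇f(x_t), y − x_t⟩ + (L/2)‖y − x_t‖² + g(y). Then for every t, F(x_{t+1}) − F(x*) ≤ (1 − min{μ/(4L), 1/2})·(F(x_t) − F(x*)), and consequently for every natural number T, F(x_T) − F(x*) ≤ exp(−T·min{μ/(4L), 1/2})·(F(x_0) − F(x*)). -/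
open scoped RealInnerProductSpace

section FirstOrder

variable {E : Type*} [NormedAddCommGroup E] [InnerProductSpace ℝ E] [CompleteSpace E]
  {X : Set E} {f : E → ℝ} {x y : E}

theorem Differentiable.hasDerivAt_comp_lineMap (hf : Differentiable ℝ f) (x y : E) (s : ℝ) :
    HasDerivAt (fun r : ℝ => f (AffineMap.lineMap x y r))
      ⟪gradient f (AffineMap.lineMap x y s), y - x⟫ s := by
  have h := (hf (AffineMap.lineMap x y s)).hasGradientAt.hasFDerivAt.comp_hasDerivAt s
    (AffineMap.hasDerivAt_lineMap (a := x) (b := y) (x := s))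
  simpa [Function.comp_def] using h

/-- A convex function lies above its tangent planes. -/
theorem ConvexOn.add_inner_gradient_le (hfc : ConvexOn ℝ X f) (hf : Differentiable ℝ f)
    (hx : x ∈ X) (hy : y ∈ X) : f x + ⟪gradient f x, y - x⟫ ≤ f y := by
  have hconv := hfc.comp_affineMap (AffineMap.lineMap x y : ℝ →ᵃ[ℝ] E)
  have hd := hf.hasDerivAt_comp_lineMap x y 0
  have h := hconv.le_slope_of_hasDerivAt (x := 0) (y := 1) (by simpa) (by simpa) one_pos hd
  simp only [slope_def_field, Function.comp_apply, AffineMap.lineMap_apply_zero,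
    AffineMap.lineMap_apply_one, sub_zero, div_one] at h
  linarith

/-- The descent lemma: a function with `L`-Lipschitz gradient on a convex set lies below the
quadratic upper models with curvature `L`. -/
theorem Convex.le_add_inner_gradient_add_sq (hX : Convex ℝ X) (hf : Differentiable ℝ f) {L : ℝ}
    (hflip : ∀ x ∈ X, ∀ y ∈ X, ‖gradient f x - gradient f y‖ ≤ L * ‖x - y‖)
    (hx : x ∈ X) (hy : y ∈ X) :
    f y ≤ f x + ⟪gradient f x, y - x⟫ + L / 2 * ‖y - x‖ ^ 2 := by
  have hd (s : ℝ) : HasDerivAt (fun r : ℝ => f (AffineMap.lineMap x y r)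
      - (r * ⟪gradient f x, y - x⟫ + L / 2 * ‖y - x‖ ^ 2 * r ^ 2))
      (⟪gradient f (AffineMap.lineMap x y s), y - x⟫
        - (⟪gradient f x, y - x⟫ + L * ‖y - x‖ ^ 2 * s)) s := by
    refine (hf.hasDerivAt_comp_lineMap x y s).sub
      ((((hasDerivAt_id s).mul_const _).add ((hasDerivAt_pow 2 s).const_mul _)).congr_deriv ?_)
    simp
    ring
  have hanti := antitoneOn_of_deriv_nonpos (convex_Icc (0 : ℝ) 1)
    (fun s _ => (hd s).continuousAt.continuousWithinAt)
    (fun s _ => (hd s).differentiableAt.differentiableWithinAt) (fun s hs => by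
      rw [interior_Icc] at hs
      rw [(hd s).deriv]
      have hmem : AffineMap.lineMap x y s ∈ X :=
        hX.lineMap_mem hx hy ⟨hs.1.le, hs.2.le⟩
      have hl := hflip _ hmem x hx
      have hn : ‖(AffineMap.lineMap x y s : E) - x‖ = s * ‖y - x‖ := by
        rw [← dist_eq_norm, dist_lineMap_left, Real.norm_of_nonneg hs.1.le, dist_comm,
          dist_eq_norm]
      rw [hn] at hl
      have hi := real_inner_le_norm (gradient f (AffineMap.lineMap x y s) - gradient f x) (y - x)
      rw [inner_sub_left] at hi
      have := mul_le_mul_of_nonneg_right hl (norm_nonneg (y - x))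
      linarith)
  have h := hanti (Set.left_mem_Icc.2 zero_le_one) (Set.right_mem_Icc.2 zero_le_one) zero_le_one
  simp only [AffineMap.lineMap_apply_zero, AffineMap.lineMap_apply_one] at h
  linarith

end FirstOrder

/-- Quadratic growth of a strongly convex function away from a minimizer. -/
theorem StrongConvexOn.sq_norm_sub_le_of_isMinOn {E : Type*} [NormedAddCommGroup E]
    [NormedSpace ℝ E] {X : Set E} {F : E → ℝ} {μ : ℝ} {x z : E} (hF : StrongConvexOn X μ F)
    (hz : z ∈ X) (hmin : IsMinOn F X z) (hx : x ∈ X) :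
    μ / 2 * ‖x - z‖ ^ 2 ≤ F x - F z := by
  have key (s : ℝ) (hs : s ∈ Set.Ioo (0 : ℝ) 1) :
      (1 - s) * (μ / 2 * ‖x - z‖ ^ 2) ≤ F x - F z := by
    have hs' : 0 ≤ 1 - s := sub_nonneg.2 hs.2.le
    have h := hF.2 hx hz hs.1.le hs' (by ring)
    have hm := hmin (hF.1 hx hz hs.1.le hs' (by ring))
    simp only [smul_eq_mul, Set.mem_ofPred_eq] at h hm
    refine le_of_mul_le_mul_left ?_ hs.1
    linarith
  have ht : Filter.Tendsto (fun s : ℝ => (1 - s) * (μ / 2 * ‖x - z‖ ^ 2))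
      (nhdsWithin 0 (Set.Ioi 0)) (nhds (μ / 2 * ‖x - z‖ ^ 2)) := by
    have hc : Continuous fun s : ℝ => (1 - s) * (μ / 2 * ‖x - z‖ ^ 2) := by fun_prop
    simpa using (hc.tendsto 0).mono_left nhdsWithin_le_nhds
  exact le_of_tendsto ht (Filter.eventually_of_mem (Ioo_mem_nhdsGT one_pos) key)

/-- One step of the composite gradient method contracts the suboptimality gap. -/
theorem composite_gradient_step_contraction {E : Type*} [NormedAddCommGroup E]
    [InnerProductSpace ℝ E] [CompleteSpace E] {X : Set E} {L μ : ℝ} (hL : 0 < L) (hμ : 0 < μ)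
    {f g : E → ℝ} (hf : Differentiable ℝ f) (hfconv : ConvexOn ℝ X f)
    (hflip : ∀ x ∈ X, ∀ y ∈ X, ‖gradient f x - gradient f y‖ ≤ L * ‖x - y‖)
    (hF : StrongConvexOn X μ (fun z => f z + g z)) {z x x' : E} (hz : z ∈ X)
    (hmin : IsMinOn (fun z => f z + g z) X z) (hx : x ∈ X) (hx' : x' ∈ X)
    (hstep : IsMinOn (fun y => ⟪gradient f x, y - x⟫ + L / 2 * ‖y - x‖ ^ 2 + g y) X x') :
    f x' + g x' - (f z + g z)
      ≤ (1 - min (μ / (4 * L)) (1 / 2)) * (f x + g x - (f z + g z)) := by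
  set m := min (μ / (4 * L)) (1 / 2) with hm
  have hm0 : 0 ≤ m := le_min (by positivity) (by norm_num)
  have hm1 : 0 ≤ 1 - 2 * m := by linarith [min_le_right (μ / (4 * L)) (1 / 2)]
  have hmL : m * (4 * L) ≤ μ := (le_div_iff₀ (by positivity)).1 (min_le_left _ _)
  have h2m : 0 ≤ 2 * m := by positivity
  have hgrow := hF.sq_norm_sub_le_of_isMinOn hz hmin hx
  have hy : (2 * m) • z + (1 - 2 * m) • x ∈ X := hfconv.1 hz hx h2m hm1 (by ring)
  have hconv := (hF.convexOn (fun r => by positivity)).2 hz hx h2m hm1 (by ring)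
  have hdesc := hfconv.1.le_add_inner_gradient_add_sq hf hflip hx hx'
  have hopt := hstep hy
  have htan := hfconv.add_inner_gradient_le hf hx hy
  have hdist : ‖(2 * m) • z + (1 - 2 * m) • x - x‖ ^ 2 = (2 * m) ^ 2 * ‖x - z‖ ^ 2 := by
    rw [show (2 * m) • z + (1 - 2 * m) • x - x = (2 * m) • (z - x) by module, norm_smul,
      Real.norm_of_nonneg h2m, norm_sub_rev, mul_pow]
  simp only [smul_eq_mul, Set.mem_ofPred_eq] at hconv hopt
  rw [hdist] at hopt
  have hquad : L / 2 * ((2 * m) ^ 2 * ‖x - z‖ ^ 2) ≤ m * (f x + g x - (f z + g z)) := by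
    have h₁ := mul_le_mul_of_nonneg_left hgrow hm0
    have h₂ := mul_le_mul_of_nonneg_right hmL (mul_nonneg hm0 (sq_nonneg ‖x - z‖))
    linarith
  linarith



/-- **Convergence of Composite Gradient Descent (CRGD), Euclidean instance.**
Proposition D.8 of "Implicit Riemannian Optimism with Applications to Min-Max Problems". -/
theorem crgd_convergence
    {E : Type*} [NormedAddCommGroup E] [InnerProductSpace ℝ E] [FiniteDimensional ℝ E]
    (X : Set E) (hXcomp : IsCompact X) (hXconv : Convex ℝ X)
    (L μ : ℝ) (hL : 0 < L) (hμ : 0 < μ)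
    (f g : E → ℝ) (hf : Differentiable ℝ f) (hfconv : ConvexOn ℝ X f)
    (hflip : ∀ x ∈ X, ∀ y ∈ X, ‖gradient f x - gradient f y‖ ≤ L * ‖x - y‖)
    (hgconv : ConvexOn ℝ X g) (hglsc : LowerSemicontinuous g)
    (hFsc : ConvexOn ℝ X (fun z => f z + g z - μ / 2 * ‖z‖ ^ 2))
    (xstar : E) (hxstarmem : xstar ∈ X)
    (hxstarmin : IsMinOn (fun z => f z + g z) X xstar)
    (x : ℕ → E) (hx0 : x 0 ∈ X)
    (hstep : ∀ t : ℕ, x (t + 1) ∈ X ∧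
      IsMinOn (fun y => ⟪gradient f (x t), y - x t⟫ + L / 2 * ‖y - x t‖ ^ 2 + g y)
        X (x (t + 1))) :
    (∀ t : ℕ,
      f (x (t + 1)) + g (x (t + 1)) - (f xstar + g xstar)
        ≤ (1 - min (μ / (4 * L)) (1 / 2)) * (f (x t) + g (x t) - (f xstar + g xstar)))
    ∧ ∀ T : ℕ,
        f (x T) + g (x T) - (f xstar + g xstar)
          ≤ Real.exp (-(T : ℝ) * min (μ / (4 * L)) (1 / 2))
            * (f (x 0) + g (x 0) - (f xstar + g xstar)) := by
  have hF : StrongConvexOn X μ (fun z => f z + g z) := strongConvexOn_iff_convex.2 hFsc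
  have hmem (t : ℕ) : x t ∈ X := by
    cases t with
    | zero => exact hx0
    | succ t => exact (hstep t).1
  have hcontr (t : ℕ) := composite_gradient_step_contraction hL hμ hf hfconv hflip hF
    hxstarmem hxstarmin (hmem t) (hmem (t + 1)) (hstep t).2
  refine ⟨hcontr, fun T => ?_⟩
  set m := min (μ / (4 * L)) (1 / 2)
  induction T with
  | zero => simp
  | succ T ih =>
    have hgap : 0 ≤ f (x T) + g (x T) - (f xstar + g xstar) := sub_nonneg.2 (hxstarmin (hmem T))
    calc _ ≤ (1 - m) * (f (x T) + g (x T) - (f xstar + g xstar)) := hcontr T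
      _ ≤ Real.exp (-m) * (f (x T) + g (x T) - (f xstar + g xstar)) := by
        gcongr
        exact Real.one_sub_le_exp_neg m
      _ ≤ Real.exp (-m) * (Real.exp (-(T : ℝ) * m)
            * (f (x 0) + g (x 0) - (f xstar + g xstar))) := by gcongr
      _ = _ := by
        rw [← mul_assoc, ← Real.exp_add]
        push_cast
        ring_nf
end

section
/- Let (M, d) be a metric space, D ≥ 0, T a positive integer, and let x_1, …, x_{T+1} and u_1, …, u_{T+1} be points of M all lying in a subset of M of diameter at most D. Then ∑_{t=1}^{T} (d(x_t, u_t)² − d(x_{t+1}, u_t)²) ≤ d(x_1, u_1)² − d(x_{T+1}, u_{T+1})² + 2D·∑_{t=1}^{T} d(u_t, u_{t+1}). -/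
/-- Squared distances from a point vary by at most `2 * D` times the displacement, as long as
the distances involved are at most `D`. -/
theorem dist_sq_sub_dist_sq_le {M : Type*} [PseudoMetricSpace M] {D : ℝ} {p q r : M}
    (hq : dist p q ≤ D) (hr : dist p r ≤ D) :
    dist p r ^ 2 - dist p q ^ 2 ≤ 2 * D * dist q r :=
  calc
    dist p r ^ 2 - dist p q ^ 2 = (dist p r + dist p q) * (dist p r - dist p q) := by ring
    _ ≤ (dist p r + dist p q) * dist q r := by
      gcongr
      linarith [dist_triangle p q r]
    _ ≤ 2 * D * dist q r := by
      gcongr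
      linarith

/-- **Telescoping path-variation inequality in a metric space.** Equation (eq:path-var)
of "Implicit Riemannian Optimism with Applications to Min-Max Problems". -/
theorem path_variation_telescoping
    {M : Type*} [MetricSpace M] (D : ℝ) (hD : 0 ≤ D)
    (T : ℕ) (hT : 0 < T) (x u : ℕ → M) (S : Set M)
    (hSdiam : ∀ p ∈ S, ∀ q ∈ S, dist p q ≤ D)
    (hx : ∀ t ∈ Finset.Icc 1 (T + 1), x t ∈ S)
    (hu : ∀ t ∈ Finset.Icc 1 (T + 1), u t ∈ S) :
    ∑ t ∈ Finset.Icc 1 T, (dist (x t) (u t) ^ 2 - dist (x (t + 1)) (u t) ^ 2)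
      ≤ dist (x 1) (u 1) ^ 2 - dist (x (T + 1)) (u (T + 1)) ^ 2
        + 2 * D * ∑ t ∈ Finset.Icc 1 T, dist (u t) (u (t + 1)) := by
  clear hT
  induction T with
  | zero => simp
  | succ n ih =>
    have hn := ih
      (fun t ht => hx t (Finset.Icc_subset_Icc_right (by omega) ht))
      (fun t ht => hu t (Finset.Icc_subset_Icc_right (by omega) ht))
    have hx_mem : x (n + 1 + 1) ∈ S := hx _ (by simp)
    have hstep := dist_sq_sub_dist_sq_le
      (hSdiam _ hx_mem _ (hu (n + 1) (by simp)))
      (hSdiam _ hx_mem _ (hu (n + 1 + 1) (by simp)))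
    rw [Finset.sum_Icc_succ_top (by omega), Finset.sum_Icc_succ_top (by omega), mul_add]
    linarith
end

section
/- Let E be a finite-dimensional real inner product space, X ⊆ E compact convex, η > 0, μ ≥ 0 and ε̄ ≥ 0. Let ℓ : E → ℝ be differentiable and μ-strongly convex on X, let x₀ ∈ X, define F(x) := ℓ(x) + (1/(2η))‖x − x₀‖², let x* be the (unique) minimizer of F on X, and let x⁺ ∈ X satisfy F(x⁺) − F(x*) ≤ (ε̄/(2η))·‖x₀ − x*‖². Then for every u ∈ X: ℓ(x⁺) − ℓ(u) ≤ (1/(2η))·(‖x₀ − u‖² − (1 + μη)‖x* − u‖² − ‖x₀ − x⁺‖² + ε̄‖x₀ − x*‖²). -/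
open Filter Topology in
/-- Quadratic growth of a strongly convex function away from a minimizer. -/
theorem StrongConvexOn.add_sq_norm_sub_le_of_isMinOn
    {E : Type*} [NormedAddCommGroup E] [NormedSpace ℝ E] {s : Set E} {m : ℝ} {f : E → ℝ}
    (hf : StrongConvexOn s m f) {x u : E} (hx : x ∈ s) (hmin : IsMinOn f s x) (hu : u ∈ s) :
    f x + m / 2 * ‖x - u‖ ^ 2 ≤ f u := by
  have hlim : Tendsto (fun t : ℝ => f x + (1 - t) * (m / 2 * ‖x - u‖ ^ 2)) (𝓝[>] 0)
      (𝓝 (f x + m / 2 * ‖x - u‖ ^ 2)) := by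
    have hcont : Continuous fun t : ℝ => f x + (1 - t) * (m / 2 * ‖x - u‖ ^ 2) := by fun_prop
    simpa using (hcont.tendsto 0).mono_left nhdsWithin_le_nhds
  refine le_of_tendsto hlim ?_
  filter_upwards [Ioo_mem_nhdsGT (zero_lt_one' ℝ)] with t ht
  have hconv := hf.2 hx hu (sub_nonneg.2 ht.2.le) ht.1.le (sub_add_cancel 1 t)
  have hle := hmin (hf.1 hx hu (sub_nonneg.2 ht.2.le) ht.1.le (sub_add_cancel 1 t))
  simp only [Set.mem_ofPred_eq, smul_eq_mul] at hconv hle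
  refine le_of_mul_le_mul_left ?_ ht.1
  linarith

/-- Adding `c * ‖z - x₀‖ ^ 2` raises the modulus of strong convexity by `2 * c`. -/
theorem StrongConvexOn.add_const_mul_sq_norm_sub
    {E : Type*} [NormedAddCommGroup E] [InnerProductSpace ℝ E] {s : Set E} {m : ℝ} {f : E → ℝ}
    (hf : StrongConvexOn s m f) (c : ℝ) (x₀ : E) :
    StrongConvexOn s (m + 2 * c) (fun z => f z + c * ‖z - x₀‖ ^ 2) := by
  rw [strongConvexOn_iff_convex] at hf ⊢
  have hlin : ConvexOn ℝ s (-(2 * c) • innerₛₗ ℝ x₀) := LinearMap.convexOn _ hf.1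
  refine ((hf.add hlin).add_const (c * ‖x₀‖ ^ 2)).congr fun z _ => ?_
  simp only [Pi.add_apply, LinearMap.smul_apply, innerₛₗ_apply_apply, smul_eq_mul,
    norm_sub_sq_real, real_inner_comm x₀ z]
  ring


/-- **Inexact proximal-step inequality, Euclidean instance.** Step ③ of (eq:omd-bound) in
the proof of Theorem A.1 of "Implicit Riemannian Optimism with Applications to Min-Max
Problems". -/
theorem inexact_proximal_step_inequality
    {E : Type*} [NormedAddCommGroup E] [InnerProductSpace ℝ E] [FiniteDimensional ℝ E]
    (X : Set E) (hXcomp : IsCompact X) (hXconv : Convex ℝ X)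
    (η : ℝ) (hη : 0 < η) (μ : ℝ) (hμ : 0 ≤ μ) (εb : ℝ) (hεb : 0 ≤ εb)
    (ℓ : E → ℝ) (hdiff : Differentiable ℝ ℓ)
    (hsc : ConvexOn ℝ X (fun z => ℓ z - μ / 2 * ‖z‖ ^ 2))
    (x₀ : E) (hx₀ : x₀ ∈ X)
    (xstar : E) (hxstarmem : xstar ∈ X)
    (hxstarmin : IsMinOn (fun z => ℓ z + 1 / (2 * η) * ‖z - x₀‖ ^ 2) X xstar)
    (xp : E) (hxp : xp ∈ X)
    (hineq : ℓ xp + 1 / (2 * η) * ‖xp - x₀‖ ^ 2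
        - (ℓ xstar + 1 / (2 * η) * ‖xstar - x₀‖ ^ 2)
      ≤ εb / (2 * η) * ‖x₀ - xstar‖ ^ 2) :
    ∀ u ∈ X,
      ℓ xp - ℓ u
        ≤ 1 / (2 * η) * (‖x₀ - u‖ ^ 2 - (1 + μ * η) * ‖xstar - u‖ ^ 2
            - ‖x₀ - xp‖ ^ 2 + εb * ‖x₀ - xstar‖ ^ 2) := by
  intro u hu
  have hgrowth := ((strongConvexOn_iff_convex.2 hsc).add_const_mul_sq_norm_sub
    (1 / (2 * η)) x₀).add_sq_norm_sub_le_of_isMinOn hxstarmem hxstarmin hu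
  simp only [norm_sub_rev xp x₀, norm_sub_rev u x₀] at hgrowth hineq ⊢
  have hsum := add_le_add hineq hgrowth
  rw [← sub_nonneg] at hsum ⊢
  refine hsum.trans_eq ?_
  field_simp
  ring
end

section
/- Let E be a finite-dimensional real inner product space, L > 0, f : E → ℝ differentiable, x* a global minimizer of f over E, and x̄ ∈ E. Set X := B̄(x*, 2‖x̄ − x*‖) and assume f is convex on X with gradient L-Lipschitz on X. Let x⁺ := x̄ − (1/L)∇f(x̄). Then x⁺ ∈ X, and (1/(2L))·‖∇f(x̄)‖² ≤ f(x̄) − f(x⁺) ≤ f(x̄) − f(x*). -/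
/-- The descent lemma on a convex set on which the gradient is `L`-Lipschitz. -/
theorem Convex.image_le_add_inner_gradient_add_sq
    {E : Type*} [NormedAddCommGroup E] [InnerProductSpace ℝ E] [CompleteSpace E]
    {L : ℝ} {f : E → ℝ} {s : Set E} (hs : Convex ℝ s)
    (hdiff : ∀ x ∈ s, DifferentiableAt ℝ f x)
    (hlip : ∀ x ∈ s, ∀ y ∈ s, ‖gradient f x - gradient f y‖ ≤ L * ‖x - y‖)
    {x v : E} (hx : x ∈ s) (hxv : x + v ∈ s) :
    f (x + v) ≤ f x + inner ℝ (gradient f x) v + L / 2 * ‖v‖ ^ 2 := by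
  have hmem : ∀ t ∈ Set.Icc (0 : ℝ) 1, x + t • v ∈ s := fun t ht =>
    hs.add_smul_mem hx hxv ht
  have hline : ∀ t ∈ Set.Icc (0 : ℝ) 1,
      HasDerivAt (fun t : ℝ => f (x + t • v)) (inner ℝ (gradient f (x + t • v)) v) t := by
    intro t ht
    have hv : HasDerivAt (fun t : ℝ => x + t • v) v t := by
      simpa using ((hasDerivAt_id t).smul_const v).const_add x
    have hf := (hdiff _ (hmem t ht)).hasGradientAt.hasFDerivAt
    exact (hf.comp_hasDerivAt t hv).congr_deriv (InnerProductSpace.toDual_apply_apply ..)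
  have hquad : ∀ t : ℝ, HasDerivAt
      (fun t : ℝ => f x + t * inner ℝ (gradient f x) v + L / 2 * ‖v‖ ^ 2 * t ^ 2)
      (inner ℝ (gradient f x) v + L * t * ‖v‖ ^ 2) t := by
    intro t
    have h := (((hasDerivAt_id t).mul_const (inner ℝ (gradient f x) v)).const_add (f x)).add
      (((hasDerivAt_id t).pow 2).const_mul (L / 2 * ‖v‖ ^ 2))
    refine h.congr_deriv ?_
    simp
    ring
  have key := image_le_of_deriv_right_le_deriv_boundary
    (fun t ht => (hline t ht).continuousAt.continuousWithinAt)
    (fun t ht => (hline t (Set.Ico_subset_Icc_self ht)).hasDerivWithinAt)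
    (B := fun t : ℝ => f x + t * inner ℝ (gradient f x) v + L / 2 * ‖v‖ ^ 2 * t ^ 2)
    (by simp)
    (fun t _ => (hquad t).continuousAt.continuousWithinAt)
    (fun t _ => (hquad t).hasDerivWithinAt)
    (fun t ht => by
      have hlip_t := hlip _ (hmem t (Set.Ico_subset_Icc_self ht)) x hx
      rw [add_sub_cancel_left, norm_smul, Real.norm_of_nonneg ht.1] at hlip_t
      have hcs := real_inner_le_norm (gradient f (x + t • v) - gradient f x) v
      rw [inner_sub_left] at hcs
      have := mul_le_mul_of_nonneg_right hlip_t (norm_nonneg v)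
      linarith)
    (Set.right_mem_Icc.2 zero_le_one)
  simpa using key


/-- **Gradient-step descent lemma with assumptions only on a ball, Euclidean instance.**
Proposition D.3 of "Implicit Riemannian Optimism with Applications to Min-Max Problems". -/
theorem gradient_step_gap_bound
    {E : Type*} [NormedAddCommGroup E] [InnerProductSpace ℝ E] [FiniteDimensional ℝ E]
    (L : ℝ) (hL : 0 < L)
    (f : E → ℝ) (hdiff : Differentiable ℝ f)
    (xstar : E) (hmin : ∀ z : E, f xstar ≤ f z)
    (xbar : E)
    (hconv : ConvexOn ℝ (Metric.closedBall xstar (2 * ‖xbar - xstar‖)) f)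
    (hlip : ∀ x ∈ Metric.closedBall xstar (2 * ‖xbar - xstar‖),
      ∀ y ∈ Metric.closedBall xstar (2 * ‖xbar - xstar‖),
        ‖gradient f x - gradient f y‖ ≤ L * ‖x - y‖) :
    xbar - (1 / L) • gradient f xbar ∈ Metric.closedBall xstar (2 * ‖xbar - xstar‖)
    ∧ 1 / (2 * L) * ‖gradient f xbar‖ ^ 2 ≤ f xbar - f (xbar - (1 / L) • gradient f xbar)
    ∧ f xbar - f (xbar - (1 / L) • gradient f xbar) ≤ f xbar - f xstar := by
  set g := gradient f xbar with hg
  have hstar : gradient f xstar = 0 := by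
    have hmin_loc : IsLocalMin f xstar := Filter.Eventually.of_forall hmin
    simp [gradient, hmin_loc.fderiv_eq_zero]
  have hxbar : xbar ∈ Metric.closedBall xstar (2 * ‖xbar - xstar‖) := by
    rw [mem_closedBall_iff_norm]
    linarith [norm_nonneg (xbar - xstar)]
  have hgrad : ‖g‖ ≤ L * ‖xbar - xstar‖ := by
    simpa [hstar] using hlip xbar hxbar xstar (Metric.mem_closedBall_self (by positivity))
  have hstep : xbar - (1 / L) • g ∈ Metric.closedBall xstar (2 * ‖xbar - xstar‖) := by
    rw [mem_closedBall_iff_norm, sub_right_comm]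
    have hsmul : ‖(1 / L) • g‖ ≤ ‖xbar - xstar‖ := by
      rw [norm_smul, Real.norm_of_nonneg (by positivity), one_div, inv_mul_le_iff₀ hL]
      exact hgrad
    linarith [norm_sub_le (xbar - xstar) ((1 / L) • g)]
  refine ⟨hstep, ?_, by linarith [hmin (xbar - (1 / L) • g)]⟩
  have hdescent := hconv.1.image_le_add_inner_gradient_add_sq (fun x _ => hdiff x) hlip hxbar
    (v := -((1 / L) • g)) (by rwa [← sub_eq_add_neg])
  rw [← sub_eq_add_neg, ← hg, inner_neg_right, real_inner_smul_right,
    real_inner_self_eq_norm_sq, norm_neg, norm_smul, Real.norm_of_nonneg (by positivity)]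
    at hdescent
  have hcoef : 1 / (2 * L) * ‖g‖ ^ 2 = 1 / L * ‖g‖ ^ 2 - L / 2 * (1 / L * ‖g‖) ^ 2 := by
    field_simp
    ring
  linarith
end

section
/- Let E be a finite-dimensional real inner product space, η > 0, ε > 0, and let F : E → ℝ be differentiable and (1/η)-strongly convex on E, with global minimizer x̃*. Let x₀, x̃ ∈ E satisfy ‖∇F(x̃)‖² ≤ ε·‖x₀ − x̃‖²/(η + 2η²ε). Then F(x̃) − F(x̃*) ≤ ε·‖x₀ − x̃*‖². -/
/-- A convex function lies above its tangent hyperplanes. -/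
theorem ConvexOn.add_fderiv_apply_sub_le {E : Type*} [NormedAddCommGroup E] [NormedSpace ℝ E]
    {s : Set E} {f : E → ℝ} {f' : E →L[ℝ] ℝ} {x y : E} (hf : ConvexOn ℝ s f) (hx : x ∈ s)
    (hy : y ∈ s) (hf' : HasFDerivAt f f' x) : f x + f' (y - x) ≤ f y := by
  have hline : ConvexOn ℝ (AffineMap.lineMap x y ⁻¹' s) (f ∘ AffineMap.lineMap (k := ℝ) x y) :=
    hf.comp_affineMap _
  have hderiv : HasDerivAt (f ∘ AffineMap.lineMap (k := ℝ) x y) (f' (y - x)) 0 := by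
    refine HasFDerivAt.comp_hasDerivAt (0 : ℝ) ?_ AffineMap.hasDerivAt_lineMap
    simpa using hf'
  have hslope := hline.le_slope_of_hasDerivAt (x := 0) (y := 1) (by simpa using hx)
    (by simpa using hy) zero_lt_one hderiv
  simp only [slope_def_field, Function.comp_apply, AffineMap.lineMap_apply_zero,
    AffineMap.lineMap_apply_one, sub_zero, div_one] at hslope
  linarith

/-- A strongly convex function lies above its tangent paraboloids. -/
theorem StrongConvexOn.add_inner_add_norm_sq_le {E : Type*} [NormedAddCommGroup E]
    [InnerProductSpace ℝ E] [CompleteSpace E] {s : Set E} {m : ℝ} {f : E → ℝ} {g x y : E}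
    (hf : StrongConvexOn s m f) (hx : x ∈ s) (hy : y ∈ s) (hg : HasGradientAt f g x) :
    f x + inner ℝ g (y - x) + m / 2 * ‖y - x‖ ^ 2 ≤ f y := by
  have htangent := (strongConvexOn_iff_convex.mp hf).add_fderiv_apply_sub_le hx hy
    (hg.hasFDerivAt.sub (((hasFDerivAt_id x).norm_sq).const_mul (m / 2)))
  have hsq := norm_sub_sq_real y x
  simp [inner_sub_right] at htangent
  rw [real_inner_comm] at hsq
  rw [hsq, inner_sub_right]
  linarith

/-- The Polyak–Łojasiewicz inequality for strongly convex functions. -/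
theorem StrongConvexOn.sub_le_norm_gradient_sq {E : Type*} [NormedAddCommGroup E]
    [InnerProductSpace ℝ E] [CompleteSpace E] {s : Set E} {m : ℝ} {f : E → ℝ} {g x y : E}
    (hf : StrongConvexOn s m f) (hm : 0 < m) (hx : x ∈ s) (hy : y ∈ s)
    (hg : HasGradientAt f g x) : 2 * m * (f x - f y) ≤ ‖g‖ ^ 2 := by
  have htangent := hf.add_inner_add_norm_sq_le hx hy hg
  have hcs := neg_le_of_abs_le (abs_real_inner_le_norm g (y - x))
  nlinarith [sq_nonneg (‖g‖ - m * ‖y - x‖)]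

/-- Quadratic growth of a strongly convex function around its minimizer. -/
theorem StrongConvexOn.norm_sq_le_sub_of_forall_le {E : Type*} [NormedAddCommGroup E]
    [InnerProductSpace ℝ E] [CompleteSpace E] {m : ℝ} {f : E → ℝ} {x : E}
    (hf : StrongConvexOn Set.univ m f) (hd : DifferentiableAt ℝ f x) (hmin : ∀ z, f x ≤ f z)
    (y : E) : m / 2 * ‖y - x‖ ^ 2 ≤ f y - f x := by
  have hzero : gradient f x = 0 := by
    have hloc : IsLocalMin f x := Filter.Eventually.of_forall hmin
    simp [gradient, hloc.fderiv_eq_zero]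
  have htangent := hf.add_inner_add_norm_sq_le (Set.mem_univ x) (Set.mem_univ y)
    hd.hasGradientAt
  rw [hzero, inner_zero_left] at htangent
  linarith

/-- **Gradient-norm stopping criterion implies the relative-accuracy criterion, Euclidean
instance.** From the proof of Corollary 3.4 of "Implicit Riemannian Optimism with
Applications to Min-Max Problems". -/
theorem gradient_norm_stopping_criterion
    {E : Type*} [NormedAddCommGroup E] [InnerProductSpace ℝ E] [FiniteDimensional ℝ E]
    (η : ℝ) (hη : 0 < η) (ε : ℝ) (hε : 0 < ε)
    (F : E → ℝ) (hdiff : Differentiable ℝ F)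
    (hsc : ConvexOn ℝ Set.univ (fun z => F z - 1 / (2 * η) * ‖z‖ ^ 2))
    (xts : E) (hmin : ∀ z : E, F xts ≤ F z)
    (x₀ xt : E)
    (hgrad : ‖gradient F xt‖ ^ 2 ≤ ε * ‖x₀ - xt‖ ^ 2 / (η + 2 * η ^ 2 * ε)) :
    F xt - F xts ≤ ε * ‖x₀ - xts‖ ^ 2 := by
  have hF : StrongConvexOn Set.univ (1 / η) F := by
    rw [strongConvexOn_iff_convex]
    convert hsc using 4
    field_simp
  have hpl := hF.sub_le_norm_gradient_sq (by positivity) (Set.mem_univ xt) (Set.mem_univ xts)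
    (hdiff xt).hasGradientAt
  have hgrowth := hF.norm_sq_le_sub_of_forall_le (hdiff xts) hmin xt
  have htri : ‖x₀ - xt‖ ^ 2 ≤ 2 * ‖x₀ - xts‖ ^ 2 + 2 * ‖xt - xts‖ ^ 2 := by
    have h := parallelogram_law_with_norm ℝ (x₀ - xts) (xt - xts)
    rw [sub_sub_sub_cancel_right] at h
    nlinarith [sq_nonneg ‖x₀ - xts + (xt - xts)‖]
  have hgap : 2 * (F xt - F xts) * (1 + 2 * η * ε) ≤ ε * ‖x₀ - xt‖ ^ 2 := by
    have h := hpl.trans hgrad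
    rw [le_div_iff₀ (by positivity)] at h
    calc 2 * (F xt - F xts) * (1 + 2 * η * ε)
        = 2 * (1 / η) * (F xt - F xts) * (η + 2 * η ^ 2 * ε) := by field_simp
      _ ≤ ε * ‖x₀ - xt‖ ^ 2 := h
  have hdist : ‖xt - xts‖ ^ 2 ≤ 2 * η * (F xt - F xts) := by
    calc ‖xt - xts‖ ^ 2 = 2 * η * (1 / η / 2 * ‖xt - xts‖ ^ 2) := by field_simp
      _ ≤ 2 * η * (F xt - F xts) := by gcongr
  nlinarith [mul_le_mul_of_nonneg_left htri hε.le, mul_le_mul_of_nonneg_left hdist hε.le]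
end
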